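/- arXiv:1011.6659 — 4 statements merged into one kernel-verified Lean document; each statement's English description precedes it below -/
import Mathlib

section
/- Reflection formula relating r_ℓ and r_∞: let ℓ ≥ 1, j ≥ 0, and 0 ≤ t ≤ ℓ, and set K = ⌈j/(2(ℓ+2))⌉. Then, as an equality of integers, r_ℓ(j,t) = Σ_{k=0}^{K} ( r_∞(j, t + 2(ℓ+2)k) − r_∞(j, (2k+2)(ℓ+2) − t − 2) ). -/
open Finset

/-- Three-point fusion rank for sl₂ at level ℓ. -/
def N₃ (ℓ a b c : ℕ) : ℕ :=
  if (a + b + c) % 2 = 0 ∧ a + b + c ≤ 2 * ℓ ∧ a ≤ (a + b + c) / 2 ∧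
      b ≤ (a + b + c) / 2 ∧ c ≤ (a + b + c) / 2 then 1 else 0

/-- Auxiliary rank function on the reversed list of weights: the recursion removes the
first two entries (the last two weights) and inserts μ. -/
def Nrev (ℓ : ℕ) : List ℕ → ℕ
  | [] => 1
  | [a] => if a = 0 then 1 else 0
  | [a, b] => if a = b then 1 else 0
  | [a, b, c] => N₃ ℓ c b a
  | a :: b :: c :: d :: rest =>
      ∑ μ ∈ Finset.range (ℓ + 1), Nrev ℓ (μ :: c :: d :: rest) * N₃ ℓ b a μ
  termination_by l => l.length

/-- The sl₂ rank N(λ₁,…,λₙ) of the conformal blocks bundle V(sl₂,ℓ,λ⃗). -/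
def N (ℓ : ℕ) (l : List ℕ) : ℕ := Nrev ℓ l.reverse

/-- Casimir scalar c(α) = α²/2 + α. -/
def cas (α : ℕ) : ℚ := (α : ℚ) ^ 2 / 2 + α

/-- Fakhruddin's degree of V(sl₂,ℓ,(μ₁,μ₂,μ₃,μ₄)) on M̄₀,₄. -/
def degF (ℓ μ₁ μ₂ μ₃ μ₄ : ℕ) : ℚ :=
  (1 / (2 * ((ℓ : ℚ) + 2))) *
    ((N ℓ [μ₁, μ₂, μ₃, μ₄] : ℚ) * (cas μ₁ + cas μ₂ + cas μ₃ + cas μ₄)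
      - ∑ α ∈ Finset.range (ℓ + 1), cas α *
          ((N₃ ℓ μ₁ μ₂ α * N₃ ℓ μ₃ μ₄ α + N₃ ℓ μ₁ μ₃ α * N₃ ℓ μ₂ μ₄ α
            + N₃ ℓ μ₁ μ₄ α * N₃ ℓ μ₂ μ₃ α : ℕ) : ℚ))

/-- r_ℓ(j,t): determined by r_ℓ(j,t)=0 for t<0 or t>ℓ, r_ℓ(0,0)=1, r_ℓ(0,t)=0 otherwise,
and r_ℓ(j,t) = r_ℓ(j−1,t−1) + r_ℓ(j−1,t+1) for j ≥ 1, 0 ≤ t ≤ ℓ. -/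
def rL (ℓ : ℕ) : ℕ → ℤ → ℕ
  | 0, t => if t = 0 then 1 else 0
  | j + 1, t =>
      if t < 0 ∨ (ℓ : ℤ) < t then 0 else rL ℓ j (t - 1) + rL ℓ j (t + 1)

/-- r_∞(j,t): determined by r_∞(j,t)=0 for t<0 or t>j, r_∞(0,0)=1,
and r_∞(j,t) = r_∞(j−1,t−1) + r_∞(j−1,t+1) for j ≥ 1, 0 ≤ t ≤ j. -/
def rInf : ℕ → ℤ → ℕ
  | 0, t => if t = 0 then 1 else 0
  | j + 1, t =>
      if t < 0 ∨ ((j : ℤ) + 1) < t then 0 else rInf j (t - 1) + rInf j (t + 1)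

/-- Fakhruddin's intersection number of D^{sl₂}_{ℓ,(1,…,1)} with the F-curve
F_{j₁,j₂,j₃,j₄}. -/
def IF (ℓ j₁ j₂ j₃ j₄ : ℕ) : ℚ :=
  ∑ μ₁ ∈ Finset.range (ℓ + 1), ∑ μ₂ ∈ Finset.range (ℓ + 1),
    ∑ μ₃ ∈ Finset.range (ℓ + 1), ∑ μ₄ ∈ Finset.range (ℓ + 1),
      degF ℓ μ₁ μ₂ μ₃ μ₄ * (rL ℓ j₁ (μ₁ : ℤ) : ℚ) * (rL ℓ j₂ (μ₂ : ℤ) : ℚ)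
        * (rL ℓ j₃ (μ₃ : ℤ) : ℚ) * (rL ℓ j₄ (μ₄ : ℤ) : ℚ)

/-- Binomial coefficient C(n,m) with integer lower argument, with the convention
C(n,m) = 0 for m < 0. -/
def chooseZ (n : ℕ) (m : ℤ) : ℕ := if m < 0 then 0 else n.choose m.toNat

theorem rL_eq_zero_of_lt {ℓ : ℕ} (j : ℕ) {t : ℤ} (h : t < 0 ∨ (ℓ : ℤ) < t) : rL ℓ j t = 0 := by
  cases j with
  | zero => rw [rL, if_neg (by omega)]
  | succ j => rw [rL, if_pos h]

theorem rInf_eq_zero_of_lt {j : ℕ} {t : ℤ} (h : t < 0 ∨ (j : ℤ) < t) : rInf j t = 0 := by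
  cases j with
  | zero => rw [rInf, if_neg (by omega)]
  | succ j => rw [rInf, if_pos (by push_cast at h; exact h)]

theorem rInf_succ {j : ℕ} {t : ℤ} (h : 0 ≤ t) :
    rInf (j + 1) t = rInf j (t - 1) + rInf j (t + 1) := by
  rw [rInf]
  split_ifs with h'
  · rw [rInf_eq_zero_of_lt (by omega), rInf_eq_zero_of_lt (by omega)]
  · rfl

/-- The alternating sum of the first `M` pairs of reflected values of `rInf`. -/
def reflectionSum (ℓ M j : ℕ) (t : ℤ) : ℤ :=
  ∑ k ∈ Finset.range M,
    ((rInf j (t + 2 * ((ℓ : ℤ) + 2) * k) : ℤ)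
      - (rInf j ((2 * (k : ℤ) + 2) * ((ℓ : ℤ) + 2) - t - 2) : ℤ))

theorem reflectionSum_neg_one {ℓ M j : ℕ} (hM : j + 1 < 2 * (ℓ + 2) * M) :
    reflectionSum ℓ M j (-1) = 0 := by
  have h := Finset.sum_range_sub' (fun k : ℕ => (rInf j (-1 + 2 * ((ℓ : ℤ) + 2) * k) : ℤ)) M
  have hM' : (j : ℤ) + 1 < 2 * (ℓ + 2) * M := by exact_mod_cast hM
  rw [rInf_eq_zero_of_lt (t := -1 + 2 * ((ℓ : ℤ) + 2) * (0 : ℕ)) (by simp),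
    rInf_eq_zero_of_lt (t := -1 + 2 * ((ℓ : ℤ) + 2) * M) (by right; linarith)] at h
  rw [reflectionSum, ← sub_self ((0 : ℕ) : ℤ), ← h]
  refine Finset.sum_congr rfl fun k _ => ?_
  congr 3
  push_cast
  ring

theorem reflectionSum_level_add_one (ℓ M j : ℕ) : reflectionSum ℓ M j (ℓ + 1) = 0 := by
  refine Finset.sum_eq_zero fun k _ => ?_
  rw [sub_eq_zero]
  congr 2
  ring

theorem reflectionSum_zero {ℓ M : ℕ} {t : ℤ} (hM : 0 < M) (h0 : 0 ≤ t) (ht : t ≤ ℓ) :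
    reflectionSum ℓ M 0 t = rL ℓ 0 t := by
  rw [reflectionSum, Finset.sum_eq_single_of_mem 0 (Finset.mem_range.2 hM)]
  · rw [rInf_eq_zero_of_lt (t := (2 * ((0 : ℕ) : ℤ) + 2) * ((ℓ : ℤ) + 2) - t - 2)
      (by right; push_cast; linarith)]
    simp [rInf, rL]
  · intro k _ hk
    have hk' : (1 : ℤ) ≤ k := by exact_mod_cast Nat.pos_of_ne_zero hk
    rw [rInf_eq_zero_of_lt (by right; push_cast; nlinarith),
      rInf_eq_zero_of_lt (by right; push_cast; nlinarith), sub_self]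

theorem reflectionSum_succ {ℓ M j : ℕ} {t : ℤ} (h0 : 0 ≤ t) (ht : t ≤ ℓ) :
    reflectionSum ℓ M (j + 1) t =
      reflectionSum ℓ M j (t - 1) + reflectionSum ℓ M j (t + 1) := by
  simp only [reflectionSum]
  rw [← Finset.sum_add_distrib]
  refine Finset.sum_congr rfl fun k _ => ?_
  have hk : (0 : ℤ) ≤ k := Nat.cast_nonneg k
  rw [rInf_succ (by positivity), rInf_succ (by nlinarith),
    show t - 1 + 2 * ((ℓ : ℤ) + 2) * k = t + 2 * ((ℓ : ℤ) + 2) * k - 1 by ring,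
    show t + 1 + 2 * ((ℓ : ℤ) + 2) * k = t + 2 * ((ℓ : ℤ) + 2) * k + 1 by ring,
    show (2 * (k : ℤ) + 2) * ((ℓ : ℤ) + 2) - (t - 1) - 2 =
      (2 * (k : ℤ) + 2) * ((ℓ : ℤ) + 2) - t - 2 + 1 by ring,
    show (2 * (k : ℤ) + 2) * ((ℓ : ℤ) + 2) - (t + 1) - 2 =
      (2 * (k : ℤ) + 2) * ((ℓ : ℤ) + 2) - t - 2 - 1 by ring]
  push_cast
  ring

theorem reflectionSum_eq_rL {ℓ M j : ℕ} (hM : j + 1 < 2 * (ℓ + 2) * M) {t : ℤ}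
    (h0 : -1 ≤ t) (ht : t ≤ ℓ + 1) : reflectionSum ℓ M j t = rL ℓ j t := by
  induction j generalizing t with
  | zero =>
    rcases h0.eq_or_lt with rfl | h0
    · rw [reflectionSum_neg_one hM, rL_eq_zero_of_lt _ (by omega), Nat.cast_zero]
    rcases ht.eq_or_lt with rfl | ht
    · rw [reflectionSum_level_add_one, rL_eq_zero_of_lt _ (by omega), Nat.cast_zero]
    exact reflectionSum_zero (Nat.pos_of_ne_zero (by rintro rfl; simp at hM))
      (by omega) (by omega)
  | succ j ih =>
    rcases h0.eq_or_lt with rfl | h0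
    · rw [reflectionSum_neg_one hM, rL_eq_zero_of_lt _ (by omega), Nat.cast_zero]
    rcases ht.eq_or_lt with rfl | ht
    · rw [reflectionSum_level_add_one, rL_eq_zero_of_lt _ (by omega), Nat.cast_zero]
    rw [reflectionSum_succ (by omega) (by omega), ih (by omega) (by omega) (by omega),
      ih (by omega) (by omega) (by omega), rL, if_neg (by omega), Nat.cast_add]

/-- Reflection formula relating r_ℓ and r_∞, where K = ⌈j/(2(ℓ+2))⌉. -/
theorem rL_eq_alternating_sum_rInf (ℓ j t : ℕ) (hℓ : 1 ≤ ℓ) (ht : t ≤ ℓ) :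
    (rL ℓ j (t : ℤ) : ℤ) =
      ∑ k ∈ Finset.range ((j + 2 * (ℓ + 2) - 1) / (2 * (ℓ + 2)) + 1),
        ((rInf j ((t : ℤ) + 2 * ((ℓ : ℤ) + 2) * k) : ℤ)
          - (rInf j ((2 * (k : ℤ) + 2) * ((ℓ : ℤ) + 2) - (t : ℤ) - 2) : ℤ)) := by
  refine (reflectionSum_eq_rL ?_ (by omega) (by omega)).symm
  have h := Nat.lt_mul_div_succ (j + 2 * (ℓ + 2) - 1) (show 0 < 2 * (ℓ + 2) by omega)
  omega
end

section
/- Closed form for r_ℓ, odd case: let ℓ ≥ 1, let j = 2x+1 and t = 2y+1 be odd with 0 ≤ t ≤ ℓ, and set K = ⌈j/(2(ℓ+2))⌉. Then, as an equality of rational numbers, r_ℓ(j,t) = Σ_{k=0}^{K} ( ((2y+2k(ℓ+2)+2)/(x+y+k(ℓ+2)+2))·C(2x+1, x−y−k(ℓ+2)) − ((2(k+1)(ℓ+2)−2y−2)/(x+(k+1)(ℓ+2)−y))·C(2x+1, x−(k+1)(ℓ+2)+y+2) ), where C(n,m) denotes the binomial coefficient with the convention C(n,m) = 0 for m < 0.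 -/
open Finset

/-- The number of `j`-step walks on `ℤ` with steps `±1` from the origin to `s`. -/
def walkCount : ℕ → ℤ → ℤ
  | 0, s => if s = 0 then 1 else 0
  | j + 1, s => walkCount j (s - 1) + walkCount j (s + 1)

theorem walkCount_neg (j : ℕ) (s : ℤ) : walkCount j (-s) = walkCount j s := by
  induction j generalizing s with
  | zero => simp [walkCount]
  | succ j ih =>
    rw [walkCount, walkCount, ← ih (s - 1), ← ih (s + 1), add_comm]
    ring_nf

theorem walkCount_eq_zero_of_lt (j : ℕ) (s : ℤ) (h : (j : ℤ) < s) : walkCount j s = 0 := by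
  induction j generalizing s with
  | zero => simp only [walkCount]; split_ifs <;> omega
  | succ j ih =>
    rw [walkCount, ih _ (by push_cast at h; omega), ih _ (by push_cast at h; omega), add_zero]

theorem chooseZ_succ (n : ℕ) (m : ℤ) :
    chooseZ (n + 1) m = chooseZ n m + chooseZ n (m - 1) := by
  rcases lt_trichotomy m 0 with h | rfl | h
  · simp [chooseZ, h, show m < 1 by omega]
  · simp [chooseZ]
  · obtain ⟨k, rfl⟩ : ∃ k : ℕ, m = (k : ℤ) + 1 := ⟨(m - 1).toNat, by omega⟩
    have h₁ : ¬ ((k : ℤ) + 1 < 0) := by omega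
    have h₂ : ((k : ℤ) + 1).toNat = k + 1 := by omega
    simp [chooseZ, h₁, h₂, Nat.choose_succ_succ, add_comm]

theorem walkCount_sub_two_mul (j : ℕ) (m : ℤ) : walkCount j (j - 2 * m) = chooseZ j m := by
  induction j generalizing m with
  | zero =>
    rcases lt_trichotomy m 0 with h | rfl | h
    · simp [walkCount, chooseZ, h, h.ne]
    · simp [walkCount, chooseZ]
    · have h₁ : m.toNat ≠ 0 := by omega
      simp [walkCount, chooseZ, h.ne', h.not_gt, Nat.choose_eq_zero_of_lt (Nat.pos_of_ne_zero h₁)]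
  | succ j ih =>
    rw [walkCount, chooseZ_succ, Nat.cast_add (chooseZ j m), ← ih m, ← ih (m - 1)]
    push_cast
    ring_nf

/-- The difference of walk counts given by reflection in `-1`; for `s ≥ 0` it counts the
nonnegative walks from `0` to `s`. -/
def ballotCount (j : ℕ) (s : ℤ) : ℤ := walkCount j s - walkCount j (s + 2)

theorem ballotCount_succ (j : ℕ) (s : ℤ) :
    ballotCount (j + 1) s = ballotCount j (s - 1) + ballotCount j (s + 1) := by
  simp only [ballotCount, walkCount]
  ring_nf

theorem ballotCount_neg_one (j : ℕ) : ballotCount j (-1) = 0 := by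
  rw [ballotCount, walkCount_neg]
  norm_num

theorem ballotCount_eq_zero_of_lt (j : ℕ) (s : ℤ) (h : (j : ℤ) < s) : ballotCount j s = 0 := by
  rw [ballotCount, walkCount_eq_zero_of_lt j s h, walkCount_eq_zero_of_lt j _ (by omega), sub_zero]

theorem chooseZ_sub_one_mul (n : ℕ) (m : ℤ) (h : m ≤ n) :
    (chooseZ n (m - 1) : ℚ) * (n - m + 1) = m * chooseZ n m := by
  rcases lt_trichotomy m 0 with h₀ | rfl | h₀
  · simp [chooseZ, h₀, show m < 1 by omega]
  · simp [chooseZ]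
  · obtain ⟨k, rfl⟩ : ∃ k : ℕ, m = (k : ℤ) + 1 := ⟨(m - 1).toNat, by omega⟩
    have h₁ : ¬ ((k : ℤ) + 1 < 0) := by omega
    have h₂ : ((k : ℤ) + 1).toNat = k + 1 := by omega
    have h₃ := congrArg (Nat.cast : ℕ → ℚ) (Nat.choose_succ_right_eq n k)
    rw [Nat.cast_mul, Nat.cast_mul, Nat.cast_sub (by omega)] at h₃
    simp only [chooseZ, h₁, h₂, add_sub_cancel_right, if_false, Int.toNat_natCast,
      show ¬ ((k : ℤ) < 0) by omega]
    push_cast at h₃ ⊢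
    linarith

theorem ballotCount_sub_two_mul (n : ℕ) (m : ℤ) (h : m ≤ n) :
    (ballotCount n (n - 2 * m) : ℚ) = (n - 2 * m + 1) / (n - m + 1) * chooseZ n m := by
  have hpos : (0 : ℚ) < n - m + 1 := by
    have : (m : ℚ) ≤ n := by exact_mod_cast h
    linarith
  rw [ballotCount, show (n : ℤ) - 2 * m + 2 = n - 2 * (m - 1) by ring, walkCount_sub_two_mul,
    walkCount_sub_two_mul, div_mul_eq_mul_div, eq_div_iff hpos.ne']
  push_cast
  linarith [chooseZ_sub_one_mul n m h]

/-- Reflection principle for walks confined to `[0, ℓ]`. -/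
theorem rL_eq_sum_ballotCount (ℓ M j : ℕ) (hM : (j : ℤ) + 1 < 2 * M * (ℓ + 2)) (t : ℤ)
    (ht₀ : -1 ≤ t) (ht₁ : t ≤ ℓ + 1) :
    (rL ℓ j t : ℤ) = ∑ k ∈ Finset.range M,
      (ballotCount j (t + 2 * k * (ℓ + 2)) - ballotCount j (2 * (k + 1) * (ℓ + 2) - 2 - t)) := by
  induction j generalizing t with
  | zero =>
    obtain ⟨M, rfl⟩ : ∃ N, M = N + 1 := Nat.exists_eq_succ_of_ne_zero (by rintro rfl; simp at hM)
    have hzero (s : ℤ) (hs : 0 < s) : ballotCount 0 s = 0 :=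
      ballotCount_eq_zero_of_lt 0 s (by simpa using hs)
    rw [Finset.sum_range_succ', Finset.sum_eq_zero]
    · rw [hzero (2 * ((0 : ℕ) + 1) * (ℓ + 2) - 2 - t) (by push_cast; linarith)]
      have h₂ : t + 2 ≠ 0 := by omega
      simp [rL, ballotCount, walkCount, h₂]
    · intro k _
      have hk : (0 : ℤ) ≤ k * (ℓ + 2) := by positivity
      rw [hzero _ (by push_cast; linarith), hzero _ (by push_cast; linarith), sub_zero]
  | succ j ih =>
    push_cast at hM
    rw [rL]
    split_ifs with h
    · rcases h with h | h
      · obtain rfl : t = -1 := by omega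
        have htel := Finset.sum_range_sub'
          (fun k : ℕ => ballotCount (j + 1) (-1 + 2 * k * (ℓ + 2))) M
        simp only [Nat.cast_zero, mul_zero, zero_mul, add_zero, ballotCount_neg_one] at htel
        rw [ballotCount_eq_zero_of_lt (j + 1) (-1 + 2 * M * (ℓ + 2)) (by push_cast; linarith)]
          at htel
        rw [Nat.cast_zero, ← sub_zero (0 : ℤ), ← htel]
        refine Finset.sum_congr rfl fun k _ => ?_
        push_cast
        ring_nf
      · obtain rfl : t = ℓ + 1 := by omega
        rw [Nat.cast_zero, Finset.sum_eq_zero]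
        intro k _
        rw [sub_eq_zero]
        congr 1
        ring
    · rw [Nat.cast_add, ih (by linarith) (t - 1) (by omega) (by omega),
        ih (by linarith) (t + 1) (by omega) (by omega), ← Finset.sum_add_distrib]
      refine Finset.sum_congr rfl fun k _ => ?_
      rw [ballotCount_succ, ballotCount_succ]
      ring_nf

/-- Closed form for r_ℓ(j,t), odd case j = 2x+1, t = 2y+1, with K = ⌈j/(2(ℓ+2))⌉. -/
theorem rL_closed_form_odd (ℓ x y : ℕ) (hℓ : 1 ≤ ℓ) (ht : 2 * y + 1 ≤ ℓ) :
    (rL ℓ (2 * x + 1) ((2 * y + 1 : ℕ) : ℤ) : ℚ) =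
      ∑ k ∈ Finset.range ((2 * x + 1 + 2 * (ℓ + 2) - 1) / (2 * (ℓ + 2)) + 1),
        ((2 * (y : ℚ) + 2 * (k : ℚ) * ((ℓ : ℚ) + 2) + 2)
            / ((x : ℚ) + (y : ℚ) + (k : ℚ) * ((ℓ : ℚ) + 2) + 2)
            * (chooseZ (2 * x + 1) ((x : ℤ) - (y : ℤ) - (k : ℤ) * ((ℓ : ℤ) + 2)) : ℚ)
          - (2 * ((k : ℚ) + 1) * ((ℓ : ℚ) + 2) - 2 * (y : ℚ) - 2)
            / ((x : ℚ) + ((k : ℚ) + 1) * ((ℓ : ℚ) + 2) - (y : ℚ))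
            * (chooseZ (2 * x + 1)
                ((x : ℤ) - ((k : ℤ) + 1) * ((ℓ : ℤ) + 2) + (y : ℤ) + 2) : ℚ)) := by
  set M := (2 * x + 1 + 2 * (ℓ + 2) - 1) / (2 * (ℓ + 2)) + 1 with hMdef
  have hM : ((2 * x + 1 : ℕ) : ℤ) + 1 < 2 * M * (ℓ + 2) := by
    have h := Nat.lt_mul_div_succ (2 * x + 1 + 2 * (ℓ + 2) - 1) (b := 2 * (ℓ + 2)) (by omega)
    rw [← hMdef] at h
    have h' : 2 * x + 1 + 1 < 2 * (ℓ + 2) * M := by omega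
    zify at h'
    push_cast
    linarith
  have hsum := rL_eq_sum_ballotCount ℓ M (2 * x + 1) hM ((2 * y + 1 : ℕ) : ℤ)
    (by omega) (by push_cast; omega)
  rw [← Int.cast_natCast (R := ℚ), hsum, Int.cast_sum]
  refine Finset.sum_congr rfl fun k _ => ?_
  have hk : (0 : ℤ) ≤ k * (ℓ + 2) := by positivity
  have hy : 2 * (y : ℤ) + 1 ≤ ℓ := by exact_mod_cast ht
  have h₁ := ballotCount_sub_two_mul (2 * x + 1) ((x : ℤ) - y - k * (ℓ + 2))
    (by push_cast; linarith)
  have h₂ := ballotCount_sub_two_mul (2 * x + 1) ((x : ℤ) - (k + 1) * (ℓ + 2) + y + 2)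
    (by push_cast; linarith)
  rw [show ((2 * x + 1 : ℕ) : ℤ) - 2 * ((x : ℤ) - y - k * (ℓ + 2))
    = ((2 * y + 1 : ℕ) : ℤ) + 2 * k * (ℓ + 2) by push_cast; ring] at h₁
  rw [show ((2 * x + 1 : ℕ) : ℤ) - 2 * ((x : ℤ) - (k + 1) * (ℓ + 2) + y + 2)
    = 2 * (k + 1) * (ℓ + 2) - 2 - ((2 * y + 1 : ℕ) : ℤ) by push_cast; ring] at h₂
  rw [Int.cast_sub, h₁, h₂]
  congr 3
  all_goals
    push_cast
    ring
end

section
/- Intersection with F-curves having two singleton legs: let ℓ ≥ 1, let n ≥ 4 be even, and let 1 ≤ i ≤ n−3. Then I_ℓ(n−i−2, i, 1, 1) = r_ℓ(i,ℓ) · r_ℓ(n−i−2,ℓ). -/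
open Finset

lemma sum_N₃_one_one (ℓ : ℕ) (hℓ : 1 ≤ ℓ) (f : ℕ → ℚ) :
    ∑ α ∈ Finset.range (ℓ + 1), f α * (N₃ ℓ 1 1 α : ℚ)
      = f 0 + if 2 ≤ ℓ then f 2 else 0 := by
  have h : ∀ α ∈ Finset.range (ℓ + 1), f α * (N₃ ℓ 1 1 α : ℚ)
      = (if α = 0 then f α else 0) + (if α = 2 then f α else 0) := by
    intro α hα
    rw [Finset.mem_range] at hα
    unfold N₃
    split_ifs <;> first | omega | simp
  rw [Finset.sum_congr rfl h, Finset.sum_add_distrib, Finset.sum_ite_eq', Finset.sum_ite_eq']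
  simp only [Finset.mem_range]
  split_ifs <;> first | omega | simp

lemma sum_N₃_one (ℓ a : ℕ) (ha : a ≤ ℓ) (f : ℕ → ℚ) :
    ∑ α ∈ Finset.range (ℓ + 1), f α * (N₃ ℓ a 1 α : ℚ)
      = (if a + 1 ≤ ℓ then f (a + 1) else 0) + if 1 ≤ a then f (a - 1) else 0 := by
  have h : ∀ α ∈ Finset.range (ℓ + 1), f α * (N₃ ℓ a 1 α : ℚ)
      = (if α = a + 1 then f α else 0) + (if α = a - 1 then (if 1 ≤ a then f α else 0) else 0) := by
    intro α hα
    rw [Finset.mem_range] at hα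
    unfold N₃
    split_ifs <;> first | omega | simp
  rw [Finset.sum_congr rfl h, Finset.sum_add_distrib, Finset.sum_ite_eq', Finset.sum_ite_eq']
  simp only [Finset.mem_range]
  split_ifs <;> first | omega | simp

lemma N_one_one (ℓ a b : ℕ) (hℓ : 1 ≤ ℓ) :
    (N ℓ [a, b, 1, 1] : ℚ) = N₃ ℓ a b 0 + if 2 ≤ ℓ then (N₃ ℓ a b 2 : ℚ) else 0 := by
  rw [← sum_N₃_one_one ℓ hℓ fun α => (N₃ ℓ a b α : ℚ)]
  simp [N, Nrev]

lemma degF_one_one (ℓ a b : ℕ) (hℓ : 1 ≤ ℓ) (ha : a ≤ ℓ) (hb : b ≤ ℓ) :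
    degF ℓ a b 1 1 = if a = ℓ then (if b = ℓ then 1 else 0) else 0 := by
  have hsum : ∑ α ∈ Finset.range (ℓ + 1), cas α *
          ((N₃ ℓ a b α * N₃ ℓ 1 1 α + N₃ ℓ a 1 α * N₃ ℓ b 1 α
            + N₃ ℓ a 1 α * N₃ ℓ b 1 α : ℕ) : ℚ)
      = ∑ α ∈ Finset.range (ℓ + 1), (cas α * N₃ ℓ a b α) * (N₃ ℓ 1 1 α : ℚ)
        + ∑ α ∈ Finset.range (ℓ + 1), (2 * cas α * N₃ ℓ b 1 α) * (N₃ ℓ a 1 α : ℚ) := by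
    rw [← Finset.sum_add_distrib]
    refine Finset.sum_congr rfl fun α _ => ?_
    push_cast
    ring
  have hℓ' : (ℓ : ℚ) + 2 ≠ 0 := by positivity
  rw [degF, hsum, sum_N₃_one_one ℓ hℓ fun α => cas α * N₃ ℓ a b α,
    sum_N₃_one ℓ a ha fun α => 2 * cas α * N₃ ℓ b 1 α, N_one_one ℓ a b hℓ]
  have key : ∀ x y : ℕ, N₃ ℓ x y 0 = (if x = y ∧ x ≤ ℓ then 1 else 0) := by
    intro x y
    unfold N₃
    split_ifs <;> omega
  have key2 : N₃ ℓ a b 2 =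
      (if (a = b ∧ 1 ≤ a ∧ a + 1 ≤ ℓ) ∨ b = a + 2 ∨ a = b + 2 then 1 else 0) := by
    unfold N₃
    split_ifs <;> omega
  have key3 : a + 1 ≤ ℓ → N₃ ℓ b 1 (a + 1) = (if a = b ∨ b = a + 2 then 1 else 0) := by
    intro h
    unfold N₃
    split_ifs <;> omega
  have key4 : 1 ≤ a → N₃ ℓ b 1 (a - 1) = (if a = b ∨ a = b + 2 then 1 else 0) := by
    intro h
    unfold N₃
    split_ifs <;> omega
  rw [key, key2]
  rcases Nat.eq_zero_or_pos a with rfl | h1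
  · by_cases hb0 : b = 0
    · subst hb0
      simp [key3 (by omega), hℓ, cas, show (0 : ℕ) ≠ ℓ by omega]
      norm_num
    · by_cases hb2 : b = 2
      · subst hb2
        simp [key3 (by omega), hℓ, hb, cas, show (0 : ℕ) ≠ ℓ by omega]
        norm_num
      · have := key3 (by omega)
        simp only [zero_add] at this
        simp [this, hb0, hb2, Ne.symm hb0, cas, show (0 : ℕ) ≠ ℓ by omega]
  · obtain ⟨a, rfl⟩ : ∃ k, a = k + 1 := ⟨a - 1, by omega⟩
    have k4 := key4 h1
    rw [Nat.add_sub_cancel] at k4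
    simp only [Nat.add_sub_cancel, k4]
    by_cases h2 : a + 1 + 1 ≤ ℓ
    · rw [key3 h2, if_neg (show ¬ a + 1 = ℓ by omega)]
      by_cases e : a + 1 = b
      · subst e
        simp [h2, ha, cas, show 2 ≤ ℓ by omega]
        right; ring
      · by_cases e2 : b = a + 1 + 2
        · subst e2
          simp [h2, cas, show 2 ≤ ℓ by omega]
          right; ring
        · by_cases e3 : a = b + 1
          · subst e3
            simp [h2, cas, e, e2, show 2 ≤ ℓ by omega]
            right; ring
          · simp [e, e2, e3]
    · obtain rfl : ℓ = a + 1 := by omega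
      by_cases e : b = a + 1
      · subst e
        simp [cas] at hℓ' ⊢
        field_simp
        ring
      · by_cases e3 : a = b + 1
        · subst e3
          simp [cas, e, Ne.symm e]
          right; ring
        · simp [e, Ne.symm e, e3, show ¬ b = a + 1 + 2 by omega]

lemma rL_one (ℓ μ : ℕ) (hμ : μ ≤ ℓ) :
    rL ℓ 1 (μ : ℤ) = if μ = 1 then 1 else 0 := by
  simp only [rL]
  split_ifs <;> omega

/-- Intersection with F-curves having two singleton legs. -/
theorem intersect_F_curve (ℓ n i : ℕ) (hℓ : 1 ≤ ℓ) (hn : 4 ≤ n) (hev : Even n)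
    (hi1 : 1 ≤ i) (hi2 : i ≤ n - 3) :
    IF ℓ (n - i - 2) i 1 1 = (rL ℓ i (ℓ : ℤ) : ℚ) * (rL ℓ (n - i - 2) (ℓ : ℤ) : ℚ) := by
  have hlegs : ∀ a ∈ Finset.range (ℓ + 1), ∀ b ∈ Finset.range (ℓ + 1),
      ∑ c ∈ Finset.range (ℓ + 1), ∑ d ∈ Finset.range (ℓ + 1),
        degF ℓ a b c d * (rL ℓ (n - i - 2) (a : ℤ) : ℚ) * (rL ℓ i (b : ℤ) : ℚ)
          * (rL ℓ 1 (c : ℤ) : ℚ) * (rL ℓ 1 (d : ℤ) : ℚ)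
      = if a = ℓ then (if b = ℓ then
          (rL ℓ (n - i - 2) (a : ℤ) : ℚ) * (rL ℓ i (b : ℤ) : ℚ) else 0) else 0 := by
    intro a ha b hb
    have h1 : 1 ∈ Finset.range (ℓ + 1) := Finset.mem_range.2 (by omega)
    have hr : ∀ c ∈ Finset.range (ℓ + 1), c ≠ 1 → rL ℓ 1 (c : ℤ) = 0 := by
      intro c hc hne
      rw [rL_one ℓ c (Nat.lt_succ_iff.1 (Finset.mem_range.1 hc)), if_neg hne]
    rw [Finset.sum_eq_single_of_mem 1 h1, Finset.sum_eq_single_of_mem 1 h1,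
      rL_one ℓ 1 hℓ, if_pos rfl, degF_one_one ℓ a b hℓ (Nat.lt_succ_iff.1 (Finset.mem_range.1 ha))
        (Nat.lt_succ_iff.1 (Finset.mem_range.1 hb))]
    · split_ifs <;> simp
    · intro d hd hne
      rw [hr d hd hne]
      simp
    · intro c hc hne
      rw [hr c hc hne]
      simp
  rw [IF, Finset.sum_congr rfl fun a ha => Finset.sum_congr rfl (hlegs a ha)]
  simp [mul_comm]
end

section
/- Level-2 intersection numbers: let g ≥ 1 and let a, b, c, d ≥ 1 be integers with a+b+c+d = 2g+2. If the product abcd is odd, then I_2(a,b,c,d) = 0. If abcd is even (in which case necessarily g ≥ 2), then I_2(a,b,c,d) = 2^{g−2}. -/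
open Finset

/-- At level two, an odd number of steps always ends at weight one. -/
lemma rL_two_odd (k : ℕ) :
    rL 2 (2 * k + 1) 0 = 0 ∧ rL 2 (2 * k + 1) 1 = 2 ^ k ∧ rL 2 (2 * k + 1) 2 = 0 := by
  induction k with
  | zero => simp [rL]
  | succ k ih =>
    obtain ⟨h0, h1, h2⟩ := ih
    have hneg : rL 2 (2 * k + 1) (-1) = 0 := by simp [rL]
    have hbig : rL 2 (2 * k + 1) 3 = 0 := by simp [rL]
    have hk : 2 * (k + 1) + 1 = (2 * k + 1) + 1 + 1 := by ring
    rw [hk]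
    generalize 2 * k + 1 = j at *
    simp [rL, h0, h1, h2, hneg, hbig, pow_succ, mul_two]

/-- At level two, a positive even number of steps ends equally often at weights zero and two. -/
lemma rL_two_even (k : ℕ) :
    rL 2 (2 * k + 2) 0 = 2 ^ k ∧ rL 2 (2 * k + 2) 1 = 0 ∧ rL 2 (2 * k + 2) 2 = 2 ^ k := by
  obtain ⟨h0, h1, h2⟩ := rL_two_odd k
  have hneg : rL 2 (2 * k + 1) (-1) = 0 := by simp [rL]
  have hbig : rL 2 (2 * k + 1) 3 = 0 := by simp [rL]
  rw [show 2 * k + 2 = (2 * k + 1) + 1 from rfl]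
  generalize 2 * k + 1 = j at *
  simp [rL, h0, h1, h2, hneg, hbig]

lemma exists_eq_odd_or_even_of_pos {n : ℕ} (hn : 1 ≤ n) :
    ∃ k, n = 2 * k + 1 ∨ n = 2 * k + 2 := ⟨(n - 1) / 2, by omega⟩

lemma N_four (ℓ a b c d : ℕ) :
    N ℓ [a, b, c, d] = ∑ μ ∈ range (ℓ + 1), N₃ ℓ a b μ * N₃ ℓ c d μ := by
  simp [N, Nrev]

set_option maxHeartbeats 1000000 in
/-- Fakhruddin's degrees at level two, for weights with an even number of ones. -/
lemma degF_two_eq {p q r s : ℕ} (hp : p ≤ 2) (hq : q ≤ 2) (hr : r ≤ 2) (hs : s ≤ 2)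
    (h : Even (p + q + r + s)) :
    degF 2 p q r s =
      if p = 2 ∧ q = 2 ∧ r = 2 ∧ s = 2 then 2
      else if p * q * r * s = 4 then 1 else 0 := by
  rw [degF, N_four]
  interval_cases p <;> interval_cases q <;> interval_cases r <;> interval_cases s <;>
    first
    | exact absurd h (by decide)
    | norm_num [N₃, cas, sum_range_succ]

/-- Level-2 intersection numbers. -/
theorem level_two_intersection (g a b c d : ℕ) (hg : 1 ≤ g) (ha : 1 ≤ a) (hb : 1 ≤ b)
    (hc : 1 ≤ c) (hd : 1 ≤ d) (hsum : a + b + c + d = 2 * g + 2) :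
    (Odd (a * b * c * d) → IF 2 a b c d = 0) ∧
    (Even (a * b * c * d) → IF 2 a b c d = 2 ^ (g - 2)) := by
  rcases exists_eq_odd_or_even_of_pos ha with ⟨i, rfl | rfl⟩ <;>
  rcases exists_eq_odd_or_even_of_pos hb with ⟨j, rfl | rfl⟩ <;>
  rcases exists_eq_odd_or_even_of_pos hc with ⟨k, rfl | rfl⟩ <;>
  rcases exists_eq_odd_or_even_of_pos hd with ⟨l, rfl | rfl⟩ <;>
  first
  | omega
  | simp [IF, sum_range_succ, rL_two_odd, rL_two_even, degF_two_eq, parity_simps]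
    first
    | done
    | rw [show g - 2 = i + j + k + l by omega]; ring
    | rw [show g - 2 = i + j + k + l + 1 by omega]; ring
end
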